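/- arXiv:1011.3272 — 2 statements merged into one kernel-verified Lean document; each statement's English description precedes it below -/
import Mathlib

section
/- For any full-rank complex T×N matrix C with T < N, the real dimension of the solution space {Y ∈ ℂ^{T×N} : C^H Y + Y^H C = 0} is at most T². -/
open Matrix

/-- The real-linear map `Y ↦ Cᴴ Y + Yᴴ C` encoding the quasi-orthogonality
constraint system. -/
noncomputable def qocMap {T N : ℕ} (C : Matrix (Fin T) (Fin N) ℂ) :
    Matrix (Fin T) (Fin N) ℂ →ₗ[ℝ] Matrix (Fin N) (Fin N) ℂ where
  toFun Y := Cᴴ * Y + Yᴴ * C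
  map_add' Y Z := by
    simp [Matrix.conjTranspose_add, Matrix.mul_add, Matrix.add_mul]
    abel
  map_smul' r Y := by
    simp [Matrix.conjTranspose_smul, Matrix.mul_smul, Matrix.smul_mul, smul_add]

/-- For any full-rank `T×N` complex matrix `C` with `T < N`, the real dimension
of the solution space of `Cᴴ Y + Yᴴ C = 0` is at most `T²`. -/
theorem stmt7 (T N : ℕ) (hTN : T < N) (C : Matrix (Fin T) (Fin N) ℂ)
    (hrank : C.rank = T) :
    Module.finrank ℝ (LinearMap.ker (qocMap C)) ≤ T ^ 2 := by
  obtain ⟨D, hD⟩ : ∃ D : Matrix (Fin N) (Fin T) ℂ, C * D = 1 := by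
    apply Matrix.mulVec_surjective_iff_exists_right_inverse.mp
    have h : LinearMap.range C.mulVecLin = ⊤ := by
      apply Submodule.eq_top_of_finrank_eq
      rw [← Matrix.rank, hrank]
      simp
    exact LinearMap.range_eq_top.mp h
  let f : Matrix (Fin T) (Fin N) ℂ →ₗ[ℝ] Matrix (Fin T) (Fin T) ℝ :=
    { toFun := fun Y => Matrix.of fun i j => ((Y * D) i j).re + ((Y * D) i j).im
      map_add' := by
        intro Y Z
        ext i j
        simp [Matrix.add_mul]
        ring
      map_smul' := by
        intro r Y
        ext i j
        simp [Matrix.smul_mul]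
        ring }
  have hinj : Function.Injective (f.domRestrict (LinearMap.ker (qocMap C))) := by
    rw [← LinearMap.ker_eq_bot, LinearMap.ker_eq_bot']
    rintro ⟨Y, hY⟩ hf
    have hY' : Cᴴ * Y + Yᴴ * C = 0 := hY
    have hDC : Dᴴ * Cᴴ = 1 := by
      rw [← Matrix.conjTranspose_mul, hD, Matrix.conjTranspose_one]
    have h1 : Y + (Y * D)ᴴ * C = 0 := by
      have := congrArg (fun M => Dᴴ * M) hY'
      simpa [Matrix.mul_add, ← Matrix.mul_assoc, hDC, Matrix.conjTranspose_mul] using this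
    have h2 : Y * D + (Y * D)ᴴ = 0 := by
      have := congrArg (fun M => M * D) h1
      simpa [Matrix.add_mul, Matrix.mul_assoc, hD] using this
    have h3 : Y * D = 0 := by
      ext i j
      have e1 : ((Y * D) i j).re + ((Y * D) i j).im = 0 := congrFun (congrFun hf i) j
      have e2 : ((Y * D) j i).re + ((Y * D) j i).im = 0 := congrFun (congrFun hf j) i
      have e3 : (Y * D) i j + star ((Y * D) j i) = 0 := congrFun (congrFun h2 i) j
      have e4 := congrArg Complex.re e3
      have e5 := congrArg Complex.im e3
      simp only [Complex.add_re, Complex.add_im, Complex.star_def, Complex.conj_re,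
        Complex.conj_im, Complex.zero_re, Complex.zero_im] at e4 e5
      apply Complex.ext
      · simp only [Matrix.zero_apply, Complex.zero_re]
        linarith
      · simp only [Matrix.zero_apply, Complex.zero_im]
        linarith
    rw [h3] at h1
    apply Subtype.ext
    simpa using h1
  have := LinearMap.finrank_le_finrank_of_injective hinj
  simpa [Module.finrank_matrix, sq] using this
end

section
/- For a complex T×N matrix C with T ≥ N, the real linear map Y ↦ C^H Y + Y^H C from ℂ^{T×N} (real dimension 2TN) to the real vector space of N×N Hermitian matrices (real dimension N²) is surjective if and only if rank(C) = N. -/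
open Matrix

/-- For `T ≥ N`, the real-linear map `Y ↦ Cᴴ Y + Yᴴ C` from `ℂ^{T×N}` onto the
space of `N×N` Hermitian matrices is surjective iff `C` has full column rank `N`. -/
theorem stmt16 (T N : ℕ) (hTN : N ≤ T) (C : Matrix (Fin T) (Fin N) ℂ) :
    (∀ H : Matrix (Fin N) (Fin N) ℂ, Hᴴ = H →
      ∃ Y : Matrix (Fin T) (Fin N) ℂ, Cᴴ * Y + Yᴴ * C = H) ↔ C.rank = N := by
  open scoped ComplexOrder in
  rw [← rank_conjTranspose_mul_self C]
  constructor
  · intro h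
    obtain ⟨Y, hY⟩ := h 1 (by simp)
    have hu : IsUnit (Cᴴ * C) := by
      rw [isUnit_iff_isUnit_det, isUnit_iff_ne_zero]
      intro hd
      obtain ⟨v, hv, hv0⟩ := exists_mulVec_eq_zero_iff.mpr hd
      open scoped ComplexOrder in
      have hC : C *ᵥ v = 0 := (conjTranspose_mul_self_mulVec_eq_zero C v).mp hv0
      have hC' : star v ᵥ* Cᴴ = 0 := by rw [← star_mulVec, hC, star_zero]
      have h1 : star v ⬝ᵥ ((Cᴴ * Y + Yᴴ * C) *ᵥ v) = 0 := by
        rw [add_mulVec, dotProduct_add, ← mulVec_mulVec, ← mulVec_mulVec, hC,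
          dotProduct_mulVec, hC']
        simp
      rw [hY, one_mulVec] at h1
      open scoped ComplexOrder in
      exact hv (dotProduct_star_self_eq_zero.mp h1)
    simpa using rank_of_isUnit _ hu
  · intro h H hH
    have hs : Function.Surjective (Cᴴ * C).mulVec := by
      have : LinearMap.range (Cᴴ * C).mulVecLin = ⊤ := by
        apply Submodule.eq_top_of_finrank_eq
        simpa [Matrix.rank] using h
      exact LinearMap.range_eq_top.mp this
    have hu : IsUnit (Cᴴ * C) := mulVec_surjective_iff_isUnit.mp hs
    have hd := (isUnit_iff_isUnit_det _).mp hu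
    have e : Cᴴ * (C * ((Cᴴ * C)⁻¹ * ((1/2 : ℂ) • H))) = (1/2 : ℂ) • H := by
      rw [← Matrix.mul_assoc, mul_nonsing_inv_cancel_left _ _ hd]
    refine ⟨C * ((Cᴴ * C)⁻¹ * ((1/2 : ℂ) • H)), ?_⟩
    have e2 := congrArg conjTranspose e
    rw [conjTranspose_mul, conjTranspose_conjTranspose, conjTranspose_smul, hH] at e2
    rw [e, e2, ← add_smul]
    have : (1/2 : ℂ) + star (1/2 : ℂ) = 1 := by
      simp; norm_num
    rw [this, one_smul]
end
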